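/- For every ε > 0 there exists a constant C > 0 (depending only on ε and on γ) such that for every positive integer m which is a sum of two squares, | ∫₀ᴸ ∫₀ᴸ r(t₁,t₂)² dt₁ dt₂ − L²/N | ≤ C · N^{ε−2}, where N = #{μ ∈ ℤ² : μ₁² + μ₂² = m}. -/

import Mathlib

open MeasureTheory ProbabilityTheory Real

noncomputable section

/-- The set of lattice points on the circle of radius `√m`:
`E = {μ ∈ ℤ² : μ₁² + μ₂² = m}` (all solutions satisfy `|μᵢ| ≤ m`). -/
def latticeSet (m : ℕ) : Finset (ℤ × ℤ) :=
  (Finset.Icc (-(m : ℤ)) (m : ℤ) ×ˢ Finset.Icc (-(m : ℤ)) (m : ℤ)).filter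
    (fun μ => μ.1 ^ 2 + μ.2 ^ 2 = (m : ℤ))

/-- `N = #E`, the number of lattice points on the circle of radius `√m`. -/
def latN (m : ℕ) : ℕ := (latticeSet m).card

/-- The covariance function of the wave restricted to the curve:
`r(t₁,t₂) = N⁻¹ ∑_{μ ∈ E} cos(2π⟨μ, γ(t₁) − γ(t₂)⟩)`. -/
def covFn (m : ℕ) (γ : ℝ → ℝ × ℝ) (t₁ t₂ : ℝ) : ℝ :=
  ((latN m : ℝ))⁻¹ *
    ∑ μ ∈ latticeSet m,
      Real.cos (2 * π * ((μ.1 : ℝ) * (γ t₁ - γ t₂).1 + (μ.2 : ℝ) * (γ t₁ - γ t₂).2))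

/-- `r₁ = ∂r/∂t₁`. -/
def covFn1 (m : ℕ) (γ : ℝ → ℝ × ℝ) (t₁ t₂ : ℝ) : ℝ :=
  deriv (fun s => covFn m γ s t₂) t₁

/-- `r₂ = ∂r/∂t₂`. -/
def covFn2 (m : ℕ) (γ : ℝ → ℝ × ℝ) (t₁ t₂ : ℝ) : ℝ :=
  deriv (fun s => covFn m γ t₁ s) t₂

/-- `r₁₂ = ∂²r/∂t₁∂t₂`. -/
def covFn12 (m : ℕ) (γ : ℝ → ℝ × ℝ) (t₁ t₂ : ℝ) : ℝ :=
  deriv (fun s => deriv (fun u => covFn m γ s u) t₂) t₁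

theorem integral_inv_sq_add_sq_le {L c B s : ℝ} (hL : 0 < L) (hc : 0 < c) (hs : 0 < s)
    (hs1 : s ≤ 1) {f g h : ℝ → ℝ} (hf : ∀ t, HasDerivAt f (g t) t)
    (hg : ∀ t, HasDerivAt g (h t) t) (hh : Continuous h)
    (hgB : ∀ t ∈ Set.Icc 0 L, |g t| ≤ B) (hhB : ∀ t ∈ Set.Icc 0 L, |h t| ≤ B)
    (hfg : ∀ t ∈ Set.Icc 0 L, c ≤ f t ^ 2 + g t ^ 2) :
    ∫ t in (0 : ℝ)..L, (f t ^ 2 + s ^ 2)⁻¹ ≤ (L + 2 * (2 * B + B * L)) / c / s := by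
  have hfc : Continuous f := continuous_iff_continuousAt.2 fun t => (hf t).continuousAt
  have hgc : Continuous g := continuous_iff_continuousAt.2 fun t => (hg t).continuousAt
  have hpos : ∀ t, 0 < f t ^ 2 + s ^ 2 := fun t => by positivity
  have hB : 0 ≤ B := (abs_nonneg _).trans (hgB 0 ⟨le_rfl, hL.le⟩)
  have hic : Continuous fun t => (f t ^ 2 + s ^ 2)⁻¹ :=
    Continuous.inv₀ (by fun_prop) fun t => (hpos t).ne'
  have harc : ∀ x : ℝ, |arctan x| ≤ 2 := fun x => by
    rw [abs_le]
    constructor <;> linarith [neg_pi_div_two_lt_arctan x, arctan_lt_pi_div_two x, pi_le_four]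
  have hderiv : ∀ t, HasDerivAt (fun t => arctan (f t / s) * g t)
      (s * (g t ^ 2 * (f t ^ 2 + s ^ 2)⁻¹) + arctan (f t / s) * h t) t := fun t => by
    refine ((((hf t).div_const s).arctan).mul (hg t)).congr_deriv ?_
    have := (hpos t).ne'
    have h2 : 1 + (f t / s) ^ 2 ≠ 0 := by positivity
    field_simp
    ring
  have hG : Continuous fun t => g t ^ 2 * (f t ^ 2 + s ^ 2)⁻¹ := by fun_prop
  have hA : Continuous fun t => arctan (f t / s) * h t :=
    (continuous_arctan.comp (by fun_prop)).mul hh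
  have hftc := intervalIntegral.integral_eq_sub_of_hasDerivAt (a := 0) (b := L)
    (fun t _ => hderiv t) (((hG.const_mul s).add hA).intervalIntegrable _ _)
  have hsG : Continuous fun t => s * (g t ^ 2 * (f t ^ 2 + s ^ 2)⁻¹) := hG.const_mul s
  rw [intervalIntegral.integral_add (hsG.intervalIntegrable _ _)
    (hA.intervalIntegrable _ _), intervalIntegral.integral_const_mul] at hftc
  have hAb : |∫ t in (0 : ℝ)..L, arctan (f t / s) * h t| ≤ 2 * B * L := by
    have := intervalIntegral.norm_integral_le_of_norm_le_const (a := 0) (b := L) (C := 2 * B)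
      (f := fun t => arctan (f t / s) * h t) (fun t ht => by
        rw [Set.uIoc_of_le hL.le] at ht
        rw [norm_mul]
        exact mul_le_mul (harc _) (hhB t ⟨ht.1.le, ht.2⟩) (norm_nonneg _) (by norm_num))
    simpa [abs_of_pos hL] using this
  have hend : ∀ t ∈ Set.Icc 0 L, |arctan (f t / s) * g t| ≤ 2 * B := fun t ht => by
    rw [abs_mul]
    exact mul_le_mul (harc _) (hgB t ht) (abs_nonneg _) (by norm_num)
  have hbound : s * ∫ t in (0 : ℝ)..L, g t ^ 2 * (f t ^ 2 + s ^ 2)⁻¹ ≤ 2 * (2 * B + B * L) := by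
    have h1 := abs_le.1 hAb
    have h2 := abs_le.1 (hend 0 ⟨le_rfl, hL.le⟩)
    have h3 := abs_le.1 (hend L ⟨hL.le, le_rfl⟩)
    linarith
  have hmono : ∫ t in (0 : ℝ)..L, (f t ^ 2 + s ^ 2)⁻¹ ≤
      ∫ t in (0 : ℝ)..L, c⁻¹ * (1 + g t ^ 2 * (f t ^ 2 + s ^ 2)⁻¹) := by
    refine intervalIntegral.integral_mono_on hL.le (hic.intervalIntegrable _ _)
      (Continuous.intervalIntegrable (by fun_prop) _ _) fun t ht => ?_
    have h1 := hpos t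
    have h2 := hfg t ht
    rw [← sub_nonneg]
    have : c⁻¹ * (1 + g t ^ 2 * (f t ^ 2 + s ^ 2)⁻¹) - (f t ^ 2 + s ^ 2)⁻¹ =
      (f t ^ 2 + g t ^ 2 - c + s ^ 2) / (c * (f t ^ 2 + s ^ 2)) := by
      field_simp
      ring
    rw [this]
    exact div_nonneg (by nlinarith [sq_nonneg s]) (by positivity)
  rw [intervalIntegral.integral_const_mul, intervalIntegral.integral_add
    (Continuous.intervalIntegrable (by fun_prop) _ _) (hG.intervalIntegrable _ _)] at hmono
  simp only [intervalIntegral.integral_const, sub_zero, smul_eq_mul, mul_one] at hmono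
  refine hmono.trans ?_
  rw [le_div_iff₀ hs, div_eq_inv_mul, mul_assoc]
  refine mul_le_mul_of_nonneg_left ?_ (by positivity)
  nlinarith

theorem abs_integral_cos_le {L c B : ℝ} (hL : 0 < L) (hc : 0 < c)
    {φ f g h : ℝ → ℝ} (hφ : ∀ t, HasDerivAt φ (f t) t) (hf : ∀ t, HasDerivAt f (g t) t)
    (hg : ∀ t, HasDerivAt g (h t) t) (hh : Continuous h)
    (hgB : ∀ t ∈ Set.Icc 0 L, |g t| ≤ B) (hhB : ∀ t ∈ Set.Icc 0 L, |h t| ≤ B)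
    (hfg : ∀ t ∈ Set.Icc 0 L, c ≤ f t ^ 2 + g t ^ 2) {s : ℝ} (hs : 0 < s) (hs1 : s ≤ 1) (α : ℝ) :
    |∫ t in (0 : ℝ)..L, cos (φ t / s ^ 2 + α)| ≤
      ((L + 2 * (2 * B + B * L)) / c * (1 + B) + 1) * s := by
  have hJ := integral_inv_sq_add_sq_le hL hc hs hs1 hf hg hh hgB hhB hfg
  have hφc : Continuous φ := continuous_iff_continuousAt.2 fun t => (hφ t).continuousAt
  have hfc : Continuous f := continuous_iff_continuousAt.2 fun t => (hf t).continuousAt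
  have hgc : Continuous g := continuous_iff_continuousAt.2 fun t => (hg t).continuousAt
  have hpos : ∀ t, 0 < f t ^ 2 + s ^ 2 := fun t => by positivity
  have hB : 0 ≤ B := (abs_nonneg _).trans (hgB 0 ⟨le_rfl, hL.le⟩)
  have hic : Continuous fun t => (f t ^ 2 + s ^ 2)⁻¹ :=
    Continuous.inv₀ (by fun_prop) fun t => (hpos t).ne'
  set J := ∫ t in (0 : ℝ)..L, (f t ^ 2 + s ^ 2)⁻¹
  set K := (L + 2 * (2 * B + B * L)) / c
  have hderiv : ∀ t, HasDerivAt (fun t => sin (φ t / s ^ 2 + α) * (f t * (f t ^ 2 + s ^ 2)⁻¹))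
      ((s ^ 2)⁻¹ * cos (φ t / s ^ 2 + α) - cos (φ t / s ^ 2 + α) * (f t ^ 2 + s ^ 2)⁻¹
        + sin (φ t / s ^ 2 + α) * (g t * (s ^ 2 - f t ^ 2) * ((f t ^ 2 + s ^ 2)⁻¹) ^ 2)) t :=
    fun t => by
      have h1 := (((hφ t).div_const (s ^ 2)).add_const α).sin
      have h2 := (hf t).mul ((((hf t).pow 2).add_const (s ^ 2)).inv (hpos t).ne')
      refine (h1.mul h2).congr_deriv ?_
      have := (hpos t).ne'
      simp only [Pi.mul_apply, Pi.inv_apply, Pi.pow_apply, Nat.cast_ofNat]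
      field_simp
      ring
  have hcos : Continuous fun t => cos (φ t / s ^ 2 + α) := by fun_prop
  have hF2 : Continuous fun t => cos (φ t / s ^ 2 + α) * (f t ^ 2 + s ^ 2)⁻¹ := hcos.mul hic
  have hF3 : Continuous fun t => sin (φ t / s ^ 2 + α) *
      (g t * (s ^ 2 - f t ^ 2) * ((f t ^ 2 + s ^ 2)⁻¹) ^ 2) := by fun_prop
  have hF1 : Continuous fun t => (s ^ 2)⁻¹ * cos (φ t / s ^ 2 + α) := by fun_prop
  have hF12 : Continuous fun t => (s ^ 2)⁻¹ * cos (φ t / s ^ 2 + α) -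
      cos (φ t / s ^ 2 + α) * (f t ^ 2 + s ^ 2)⁻¹ := hF1.sub hF2
  have hftc := intervalIntegral.integral_eq_sub_of_hasDerivAt (a := 0) (b := L)
    (fun t _ => hderiv t) ((hF12.add hF3).intervalIntegrable _ _)
  rw [intervalIntegral.integral_add (hF12.intervalIntegrable _ _)
    (hF3.intervalIntegrable _ _), intervalIntegral.integral_sub (hF1.intervalIntegrable _ _)
    (hF2.intervalIntegrable _ _), intervalIntegral.integral_const_mul] at hftc
  have hb2 : |∫ t in (0 : ℝ)..L, cos (φ t / s ^ 2 + α) * (f t ^ 2 + s ^ 2)⁻¹| ≤ J := by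
    refine intervalIntegral.norm_integral_le_of_norm_le (f := fun t =>
      cos (φ t / s ^ 2 + α) * (f t ^ 2 + s ^ 2)⁻¹) hL.le (Filter.Eventually.of_forall fun t _ => ?_)
      (hic.intervalIntegrable _ _)
    rw [norm_mul, norm_inv, Real.norm_of_nonneg (hpos t).le]
    exact mul_le_of_le_one_left (inv_nonneg.2 (hpos t).le) (abs_cos_le_one _)
  have hb3 : |∫ t in (0 : ℝ)..L, sin (φ t / s ^ 2 + α) *
      (g t * (s ^ 2 - f t ^ 2) * ((f t ^ 2 + s ^ 2)⁻¹) ^ 2)| ≤ B * J := by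
    rw [← intervalIntegral.integral_const_mul]
    refine intervalIntegral.norm_integral_le_of_norm_le (f := fun t => sin (φ t / s ^ 2 + α) *
      (g t * (s ^ 2 - f t ^ 2) * ((f t ^ 2 + s ^ 2)⁻¹) ^ 2)) hL.le
      (Filter.Eventually.of_forall fun t ht => ?_)
      (Continuous.intervalIntegrable (by fun_prop) _ _)
    have h1 := hgB t ⟨ht.1.le, ht.2⟩
    have h2 : |s ^ 2 - f t ^ 2| ≤ f t ^ 2 + s ^ 2 := by
      rw [abs_le]; constructor <;> nlinarith [sq_nonneg s, sq_nonneg (f t)]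
    have h3 := hpos t
    rw [norm_mul, norm_mul, norm_mul, norm_pow, norm_inv, Real.norm_of_nonneg h3.le]
    simp only [Real.norm_eq_abs]
    calc _ ≤ 1 * (B * (f t ^ 2 + s ^ 2) * ((f t ^ 2 + s ^ 2)⁻¹) ^ 2) := by
          gcongr
          exact abs_sin_le_one _
      _ = _ := by field_simp
  have hend : ∀ t, |sin (φ t / s ^ 2 + α) * (f t * (f t ^ 2 + s ^ 2)⁻¹)| ≤ 1 / (2 * s) := fun t => by
    rw [abs_mul, abs_mul, abs_inv, abs_of_pos (hpos t)]
    refine (mul_le_of_le_one_left (by have := hpos t; positivity) (abs_sin_le_one _)).trans ?_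
    rw [← div_eq_mul_inv, div_le_div_iff₀ (hpos t) (by positivity)]
    nlinarith [sq_nonneg (|f t| - s), sq_abs (f t)]
  have h0 := hend 0
  have h1 := hend L
  set I := ∫ t in (0 : ℝ)..L, cos (φ t / s ^ 2 + α)
  have key : (s ^ 2)⁻¹ * |I| ≤ J + B * J + 1 / s := by
    rw [← abs_of_pos (show 0 < (s ^ 2)⁻¹ by positivity), ← abs_mul]
    have e : 1 / s = 1 / (2 * s) + 1 / (2 * s) := by field_simp; norm_num
    rw [abs_le] at *
    constructor <;> linarith
  have : J + B * J + 1 / s ≤ (K * (1 + B) + 1) / s := by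
    have : J * (1 + B) ≤ K / s * (1 + B) := by gcongr
    calc _ = J * (1 + B) + 1 / s := by ring
      _ ≤ K / s * (1 + B) + 1 / s := by gcongr
      _ = _ := by ring
  have h4 := key.trans this
  rw [inv_mul_le_iff₀ (by positivity)] at h4
  refine h4.trans (le_of_eq ?_)
  field_simp

theorem min_le_sq_add_sq {u v x y p q : ℝ} (huv : u ^ 2 + v ^ 2 = 1) (hxy : x ^ 2 + y ^ 2 = 1)
    (hperp : x * p + y * q = 0) :
    min 1 (p ^ 2 + q ^ 2) ≤ (u * x + v * y) ^ 2 + (u * p + v * q) ^ 2 := by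
  have hp : p = -(x * q - y * p) * y := by linear_combination x * hperp - p * hxy
  have hq : q = (x * q - y * p) * x := by linear_combination y * hperp - q * hxy
  set κ := x * q - y * p
  have h1 : p ^ 2 + q ^ 2 = κ ^ 2 := by rw [hp, hq]; linear_combination κ ^ 2 * hxy
  have h2 : (u * p + v * q) ^ 2 = κ ^ 2 * (u * y - v * x) ^ 2 := by rw [hp, hq]; ring
  have h3 : (u * x + v * y) ^ 2 + (u * y - v * x) ^ 2 = 1 := by
    linear_combination (x ^ 2 + y ^ 2) * huv + hxy
  rw [h1, h2]
  calc min 1 (κ ^ 2) = min 1 (κ ^ 2) * (u * x + v * y) ^ 2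
        + min 1 (κ ^ 2) * (u * y - v * x) ^ 2 := by rw [← mul_add, h3, mul_one]
    _ ≤ 1 * (u * x + v * y) ^ 2 + κ ^ 2 * (u * y - v * x) ^ 2 := by
        gcongr
        · exact min_le_left _ _
        · exact min_le_right _ _
    _ = _ := by ring

theorem exists_sq_integral_cos_add_sq_integral_sin_le {L : ℝ} (hL : 0 < L) {x y : ℝ → ℝ}
    (hx : ContDiff ℝ (⊤ : ℕ∞) x) (hy : ContDiff ℝ (⊤ : ℕ∞) y)
    (hunit : ∀ t ∈ Set.Icc 0 L, deriv x t ^ 2 + deriv y t ^ 2 = 1)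
    (hcurv : ∀ t ∈ Set.Icc 0 L, 0 < deriv (deriv x) t ^ 2 + deriv (deriv y) t ^ 2) :
    ∃ C > 0, ∀ a b : ℝ, 1 ≤ a ^ 2 + b ^ 2 →
      (∫ t in (0 : ℝ)..L, cos (2 * π * (a * x t + b * y t))) ^ 2 +
        (∫ t in (0 : ℝ)..L, sin (2 * π * (a * x t + b * y t))) ^ 2 ≤ C / √(a ^ 2 + b ^ 2) := by
  have hd : ∀ {z : ℝ → ℝ}, ContDiff ℝ (⊤ : ℕ∞) z →
      ContDiff ℝ (⊤ : ℕ∞) (deriv z) ∧ ∀ t, HasDerivAt z (deriv z t) t := fun {z} hz =>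
    ⟨(contDiff_infty_iff_deriv.1 hz).2, fun t => ((contDiff_infty_iff_deriv.1 hz).1 t).hasDerivAt⟩
  obtain ⟨hx1, hx'⟩ := hd hx
  obtain ⟨hy1, hy'⟩ := hd hy
  obtain ⟨hx2, hx1'⟩ := hd hx1
  obtain ⟨hy2, hy1'⟩ := hd hy1
  obtain ⟨hx3, hx2'⟩ := hd hx2
  obtain ⟨hy3, hy2'⟩ := hd hy2
  have hperp : ∀ t ∈ Set.Icc 0 L,
      deriv x t * deriv (deriv x) t + deriv y t * deriv (deriv y) t = 0 := fun t ht => by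
    have h1 := (((hx1' t).pow 2).add ((hy1' t).pow 2)).hasDerivWithinAt (s := Set.Icc 0 L)
    have h2 : HasDerivWithinAt (deriv x ^ 2 + deriv y ^ 2) 0 (Set.Icc 0 L) t :=
      (hasDerivWithinAt_const t (Set.Icc 0 L) (1 : ℝ)).congr hunit (hunit t ht)
    have h3 := (uniqueDiffOn_Icc hL t ht).eq_deriv _ h1 h2
    norm_num at h3
    linarith
  have hbdd : ∀ {z : ℝ → ℝ}, Continuous z → ∃ B, ∀ t ∈ Set.Icc 0 L, |z t| ≤ B := fun hz =>
    isCompact_Icc.exists_bound_of_continuousOn hz.continuousOn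
  obtain ⟨Bx2, hBx2⟩ := hbdd hx2.continuous
  obtain ⟨By2, hBy2⟩ := hbdd hy2.continuous
  obtain ⟨Bx3, hBx3⟩ := hbdd hx3.continuous
  obtain ⟨By3, hBy3⟩ := hbdd hy3.continuous
  set B := max (Bx2 + By2) (Bx3 + By3) with hB
  obtain ⟨t₀, ht₀, hmin⟩ := isCompact_Icc.exists_isMinOn (Set.nonempty_Icc.2 hL.le)
    (f := fun t => deriv (deriv x) t ^ 2 + deriv (deriv y) t ^ 2)
    (Continuous.continuousOn (by fun_prop))
  set c := min 1 (deriv (deriv x) t₀ ^ 2 + deriv (deriv y) t₀ ^ 2) with hc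
  have hcpos : 0 < c := lt_min one_pos (hcurv t₀ ht₀)
  set K := (L + 2 * (2 * B + B * L)) / c * (1 + B) + 1 with hK
  refine ⟨2 * K ^ 2 + 1, by positivity, fun a b hab => ?_⟩
  set r := √(a ^ 2 + b ^ 2) with hr
  have hr1 : 1 ≤ r := Real.one_le_sqrt.2 hab
  have hr0 : 0 < r := by linarith
  have hrr : r ^ 2 = a ^ 2 + b ^ 2 := Real.sq_sqrt (by positivity)
  have huv : (a / r) ^ 2 + (b / r) ^ 2 = 1 := by field_simp; linarith
  have hu1 : |a / r| ≤ 1 := by rw [← sq_le_one_iff_abs_le_one]; nlinarith [sq_nonneg (b / r)]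
  have hv1 : |b / r| ≤ 1 := by rw [← sq_le_one_iff_abs_le_one]; nlinarith [sq_nonneg (a / r)]
  set s := (√(2 * π * r))⁻¹ with hs
  have hπr : 1 ≤ 2 * π * r := by nlinarith [pi_gt_three]
  have hs0 : 0 < s := by positivity
  have hs1 : s ≤ 1 := inv_le_one_of_one_le₀ (Real.one_le_sqrt.2 hπr)
  have hs2 : s ^ 2 = (2 * π * r)⁻¹ := by rw [hs, inv_pow, Real.sq_sqrt (by linarith)]
  have hlin : ∀ {z w z' w' : ℝ → ℝ}, (∀ t, HasDerivAt z (z' t) t) → (∀ t, HasDerivAt w (w' t) t) →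
      ∀ t, HasDerivAt (fun t => a / r * z t + b / r * w t) (a / r * z' t + b / r * w' t) t :=
    fun hz hw t => ((hz t).const_mul _).add ((hw t).const_mul _)
  have hlinB : ∀ {p q P Q : ℝ}, |p| ≤ P → |q| ≤ Q → |a / r * p + b / r * q| ≤ P + Q :=
    fun {p q P Q} hp hq => by
      refine (abs_add_le _ _).trans (add_le_add ?_ ?_) <;> rw [abs_mul]
      · exact (mul_le_of_le_one_left (abs_nonneg _) hu1).trans hp
      · exact (mul_le_of_le_one_left (abs_nonneg _) hv1).trans hq
  have main : ∀ α, |∫ t in (0 : ℝ)..L, cos (2 * π * (a * x t + b * y t) + α)| ≤ K * s := fun α => by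
    have := abs_integral_cos_le hL hcpos (B := B) (hlin hx' hy') (hlin hx1' hy1') (hlin hx2' hy2')
      (by fun_prop) (fun t ht => (hlinB (hBx2 t ht) (hBy2 t ht)).trans (le_max_left _ _))
      (fun t ht => (hlinB (hBx3 t ht) (hBy3 t ht)).trans (le_max_right _ _))
      (fun t ht => le_trans (min_le_min_left _ (hmin ht))
        (min_le_sq_add_sq huv (hunit t ht) (hperp t ht))) hs0 hs1 α
    convert this using 6 with t
    rw [hs2]
    field_simp
  have hcos := main 0
  have hsin := main (-(π / 2))
  simp only [add_zero, ← sub_eq_add_neg, cos_sub_pi_div_two] at hcos hsin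
  have hKs : (K * s) ^ 2 ≤ K ^ 2 / r := by
    rw [mul_pow, hs2, div_eq_mul_inv]
    gcongr
    nlinarith [pi_gt_three]
  have h1 := sq_le_sq' (abs_le.1 hcos).1 (abs_le.1 hcos).2
  have h2 := sq_le_sq' (abs_le.1 hsin).1 (abs_le.1 hsin).2
  calc _ ≤ K ^ 2 / r + K ^ 2 / r := by linarith
    _ = (2 * K ^ 2) / r := by ring
    _ ≤ _ := by gcongr; linarith

theorem mem_latticeSet {m : ℕ} {μ : ℤ × ℤ} :
    μ ∈ latticeSet m ↔ μ.1 ^ 2 + μ.2 ^ 2 = (m : ℤ) := by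
  refine ⟨fun h => (Finset.mem_filter.1 h).2, fun h => Finset.mem_filter.2 ⟨?_, h⟩⟩
  simp only [Finset.mem_product, Finset.mem_Icc]
  have key : ∀ z w : ℤ, z ^ 2 + w ^ 2 = m → -(m : ℤ) ≤ z ∧ z ≤ m := fun z w h => by
    have h1 := Int.le_self_sq z
    have h2 := Int.le_self_sq (-z)
    constructor <;> nlinarith [sq_nonneg w]
  exact ⟨key _ _ h, key _ _ (by rw [add_comm]; exact h)⟩

/-- The product of the squared side lengths of a triangle inscribed in a circle of squared radius
`n` is `4 * n` times the square of twice its area. -/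
theorem prod_sq_sides_eq {n x y a b c d : ℤ} (h : x ^ 2 + y ^ 2 = n)
    (h1 : (x + a) ^ 2 + (y + b) ^ 2 = n) (h2 : (x + c) ^ 2 + (y + d) ^ 2 = n) :
    (a ^ 2 + b ^ 2) * (c ^ 2 + d ^ 2) * ((a - c) ^ 2 + (b - d) ^ 2) =
      4 * n * (a * d - b * c) ^ 2 := by
  have hx : 2 * (a * d - b * c) * x = b * (c ^ 2 + d ^ 2) - d * (a ^ 2 + b ^ 2) := by
    linear_combination d * (h1 - h) - b * (h2 - h)
  have hy : 2 * (a * d - b * c) * y = c * (a ^ 2 + b ^ 2) - a * (c ^ 2 + d ^ 2) := by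
    linear_combination a * (h2 - h) - c * (h1 - h)
  have : 4 * n * (a * d - b * c) ^ 2 =
      (2 * (a * d - b * c) * x) ^ 2 + (2 * (a * d - b * c) * y) ^ 2 := by rw [← h]; ring
  rw [this, hx, hy]
  ring

theorem abs_sub_le_of_abs_le {n x y x' y' : ℤ} (hn : 0 < n) (h : x ^ 2 + y ^ 2 = n)
    (h' : x' ^ 2 + y' ^ 2 = n) (hxy : |x| ≤ y) (hxy' : |x'| ≤ y') : |y - y'| ≤ |x - x'| := by
  have hy : 0 < y + y' := by
    by_contra hneg
    have h1 : y = 0 := by linarith [abs_nonneg x, abs_nonneg x']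
    have h2 : x = 0 := abs_eq_zero.1 (le_antisymm (by linarith) (abs_nonneg x))
    rw [h1, h2] at h
    norm_num at h
    omega
  refine le_of_mul_le_mul_right ?_ hy
  calc |y - y'| * (y + y') = |(y - y') * (y + y')| := by rw [abs_mul, abs_of_pos hy]
    _ = |x - x'| * |x + x'| := by
      rw [← abs_mul, ← abs_neg]
      congr 1
      linear_combination h' - h
    _ ≤ _ := by
      gcongr
      exact (abs_add_le _ _).trans (add_le_add hxy hxy')

set_option maxHeartbeats 1000000 in
theorem card_latticeSet_le {n : ℕ} (hn : 0 < n) :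
    ((latticeSet n).card : ℝ) ≤ 48 * (n : ℝ) ^ (1 / 3 : ℝ) := by
  have hn1 : (1 : ℝ) ≤ n := by exact_mod_cast hn
  have hn0 : (0 : ℝ) < n := by linarith
  have hnz : (0 : ℤ) < n := by exact_mod_cast hn
  set T := (latticeSet n).filter (fun p => |p.1| ≤ p.2) with hT
  set s : ℝ := (n : ℝ) ^ (1 / 6 : ℝ) / 2 with hs
  have hs0 : 0 < s := by positivity
  have hs6 : s ^ 6 = n / 64 := by
    rw [hs, div_pow, ← Real.rpow_natCast, ← Real.rpow_mul hn0.le]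
    norm_num
  have hmemT : ∀ p ∈ T, p.1 ^ 2 + p.2 ^ 2 = (n : ℤ) ∧ |p.1| ≤ p.2 := fun p hp =>
    ⟨mem_latticeSet.1 (Finset.mem_filter.1 hp).1, (Finset.mem_filter.1 hp).2⟩
  have hdist : ∀ p ∈ T, ∀ q ∈ T, ⌊(p.1 : ℝ) / s⌋ = ⌊(q.1 : ℝ) / s⌋ →
      (((q.1 - p.1) ^ 2 + (q.2 - p.2) ^ 2 : ℤ) : ℝ) ≤ 2 * s ^ 2 := fun p hp q hq hpq => by
    have h1 := Int.abs_sub_lt_one_of_floor_eq_floor hpq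
    rw [← sub_div, abs_div, abs_of_pos hs0, div_lt_one hs0, abs_sub_comm] at h1
    have h2 := abs_sub_le_of_abs_le hnz (hmemT q hq).1 (hmemT p hp).1 (hmemT q hq).2 (hmemT p hp).2
    have h3 : |(q.2 : ℝ) - p.2| ≤ |(q.1 : ℝ) - p.1| := by exact_mod_cast h2
    have h4 := sq_le_sq' (by linarith [abs_nonneg ((q.1 : ℝ) - p.1)]) h1.le
    have h5 := sq_le_sq' (by linarith [abs_nonneg ((q.2 : ℝ) - p.2)]) (h3.trans h1.le)
    rw [sq_abs] at h4 h5
    push_cast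
    linarith
  have hpos : ∀ {p q : ℤ × ℤ}, p ≠ q → 0 < (q.1 - p.1) ^ 2 + (q.2 - p.2) ^ 2 := fun {p q} hpq => by
    by_contra! hle
    refine hpq (Prod.ext ?_ ?_) <;> nlinarith [sq_nonneg (q.1 - p.1), sq_nonneg (q.2 - p.2)]
  have hfib : ∀ k ∈ T.image (fun p => ⌊(p.1 : ℝ) / s⌋),
      (T.filter (fun p => ⌊(p.1 : ℝ) / s⌋ = k)).card ≤ 2 := fun k _ => by
    by_contra! hcard
    obtain ⟨p, q, r, hp, hq, hr, hpq, hpr, hqr⟩ := Finset.two_lt_card_iff.1 hcard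
    obtain ⟨hp, hpk⟩ := Finset.mem_filter.1 hp
    obtain ⟨hq, hqk⟩ := Finset.mem_filter.1 hq
    obtain ⟨hr, hrk⟩ := Finset.mem_filter.1 hr
    have d1 := hdist p hp q hq (hpk.trans hqk.symm)
    have d2 := hdist p hp r hr (hpk.trans hrk.symm)
    have d3 := hdist r hr q hq (hrk.trans hqk.symm)
    have id := prod_sq_sides_eq (n := n) (x := p.1) (y := p.2) (a := q.1 - p.1) (b := q.2 - p.2)
      (c := r.1 - p.1) (d := r.2 - p.2) (hmemT p hp).1 (by simpa using (hmemT q hq).1)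
      (by simpa using (hmemT r hr).1)
    rw [sub_sub_sub_cancel_right, sub_sub_sub_cancel_right] at id
    have e1 := hpos hpq
    have e2 := hpos hpr
    have e3 := hpos hqr.symm
    have hprod := mul_pos (mul_pos e1 e2) e3
    set D := (q.1 - p.1) * (r.2 - p.2) - (q.2 - p.2) * (r.1 - p.1)
    have hD : 1 ≤ D ^ 2 := by
      by_contra! hlt
      have : D ^ 2 = 0 := le_antisymm (by omega) (sq_nonneg D)
      rw [id, this] at hprod
      simp at hprod
    have hge : 4 * (n : ℤ) ≤ ((q.1 - p.1) ^ 2 + (q.2 - p.2) ^ 2) *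
        ((r.1 - p.1) ^ 2 + (r.2 - p.2) ^ 2) * ((q.1 - r.1) ^ 2 + (q.2 - r.2) ^ 2) := by
      rw [id]; nlinarith
    generalize (q.1 - p.1) ^ 2 + (q.2 - p.2) ^ 2 = X at d1 e1 hge
    generalize (r.1 - p.1) ^ 2 + (r.2 - p.2) ^ 2 = Y at d2 e2 hge
    generalize (q.1 - r.1) ^ 2 + (q.2 - r.2) ^ 2 = Z at d3 e3 hge
    have hge' : 4 * (n : ℝ) ≤ (2 * s ^ 2) * (2 * s ^ 2) * (2 * s ^ 2) := by
      have e2' : (0 : ℝ) ≤ Y := by exact_mod_cast e2.le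
      have e3' : (0 : ℝ) ≤ Z := by exact_mod_cast e3.le
      calc 4 * (n : ℝ) ≤ X * Y * Z := by exact_mod_cast hge
        _ ≤ _ := mul_le_mul (mul_le_mul d1 d2 e2' (by positivity)) d3 e3' (by positivity)
    have : (2 * s ^ 2) * (2 * s ^ 2) * (2 * s ^ 2) = 8 * s ^ 6 := by ring
    rw [this, hs6] at hge'
    linarith
  have hsqrt : √(n : ℝ) / s = 2 * (n : ℝ) ^ (1 / 3 : ℝ) := by
    rw [hs, Real.sqrt_eq_rpow, div_eq_iff (by positivity)]
    have : (n : ℝ) ^ (1 / 2 : ℝ) = (n : ℝ) ^ (1 / 3 : ℝ) * (n : ℝ) ^ (1 / 6 : ℝ) := by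
      rw [← Real.rpow_add hn0]; norm_num
    rw [this]; ring
  have himg : T.image (fun p => ⌊(p.1 : ℝ) / s⌋) ⊆
      Finset.Icc ⌊-(√(n : ℝ) / s)⌋ ⌊√(n : ℝ) / s⌋ := fun k hk => by
    obtain ⟨p, hp, rfl⟩ := Finset.mem_image.1 hk
    have h1 : (p.1 : ℝ) ^ 2 + (p.2 : ℝ) ^ 2 = n := by exact_mod_cast (hmemT p hp).1
    have h2 := abs_le.1 (Real.abs_le_sqrt (show (p.1 : ℝ) ^ 2 ≤ n by nlinarith))
    rw [Finset.mem_Icc, ← neg_div]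
    exact ⟨Int.floor_le_floor (by gcongr; exact h2.1), Int.floor_le_floor (by gcongr; exact h2.2)⟩
  have hpow1 : (1 : ℝ) ≤ (n : ℝ) ^ (1 / 3 : ℝ) := Real.one_le_rpow hn1 (by norm_num)
  have himgcard : ((T.image (fun p => ⌊(p.1 : ℝ) / s⌋)).card : ℝ) ≤ 6 * (n : ℝ) ^ (1 / 3 : ℝ) := by
    refine (Nat.cast_le.2 (Finset.card_le_card himg)).trans ?_
    rw [Int.card_Icc, ← Int.cast_natCast, Int.toNat_of_nonneg]
    · push_cast
      have := Int.floor_le (√(n : ℝ) / s)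
      have := Int.lt_floor_add_one (-(√(n : ℝ) / s))
      linarith
    · have := Int.floor_le_floor (show -(√(n : ℝ) / s) ≤ √(n : ℝ) / s by
        linarith [show 0 ≤ √(n : ℝ) / s by positivity])
      omega
  have hTcard : (T.card : ℝ) ≤ 12 * (n : ℝ) ^ (1 / 3 : ℝ) := by
    have := Finset.card_le_mul_card_image (f := fun p : ℤ × ℤ => ⌊(p.1 : ℝ) / s⌋) T 2 hfib
    have : (T.card : ℝ) ≤ 2 * ((T.image (fun p => ⌊(p.1 : ℝ) / s⌋)).card : ℝ) := by
      exact_mod_cast this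
    linarith
  have hcover : latticeSet n ⊆ T ∪ T.image (fun p => (p.1, -p.2)) ∪ T.image (fun p => (p.2, p.1)) ∪
      T.image (fun p => (-p.2, p.1)) := fun p hp => by
    rw [mem_latticeSet] at hp
    have hmk : ∀ q : ℤ × ℤ, q.1 ^ 2 + q.2 ^ 2 = (n : ℤ) → |q.1| ≤ q.2 → q ∈ T := fun q h1 h2 =>
      Finset.mem_filter.2 ⟨mem_latticeSet.2 h1, h2⟩
    simp only [Finset.mem_union, Finset.mem_image]
    rcases le_total |p.1| |p.2| with h | h
    · rcases le_total 0 p.2 with h0 | h0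
      · exact Or.inl (Or.inl (Or.inl (hmk p hp (by rwa [abs_of_nonneg h0] at h))))
      · exact Or.inl (Or.inl (Or.inr ⟨(p.1, -p.2), hmk _ (by simpa using hp)
          (by rwa [abs_of_nonpos h0] at h), by simp⟩))
    · rcases le_total 0 p.1 with h0 | h0
      · exact Or.inl (Or.inr ⟨(p.2, p.1), hmk _ (by simpa [add_comm] using hp)
          (by rwa [abs_of_nonneg h0] at h), rfl⟩)
      · exact Or.inr ⟨(p.2, -p.1), hmk _ (by simpa [add_comm] using hp)
          (by rwa [abs_of_nonpos h0] at h), by simp⟩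
  have hle : (latticeSet n).card ≤ T.card + T.card + T.card + T.card := by
    refine (Finset.card_le_card hcover).trans ?_
    refine (Finset.card_union_le _ _).trans (add_le_add ?_ Finset.card_image_le)
    refine (Finset.card_union_le _ _).trans (add_le_add ?_ Finset.card_image_le)
    exact (Finset.card_union_le _ _).trans (add_le_add le_rfl Finset.card_image_le)
  have : ((latticeSet n).card : ℝ) ≤ T.card + T.card + T.card + T.card := by exact_mod_cast hle
  linarith

theorem two_mul_card_latticeSet_le {p u v a m : ℕ} (hp : p.Prime) (hp2 : p ≠ 2)
    (huv : u ^ 2 + v ^ 2 = p) (ha : a ≠ 0) (hpm : ¬ p ∣ m) :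
    2 * (latticeSet m).card ≤ (latticeSet (p ^ a * m)).card := by
  have hpz : Prime (p : ℤ) := Nat.prime_iff_prime_int.1 hp
  set w : GaussianInt := ⟨u, v⟩ with hw
  have hnw : Zsqrtd.norm w = p := by
    rw [Zsqrtd.norm_def, ← huv]; push_cast; ring
  have hirr : Irreducible w := by
    refine ⟨fun hu => ?_, fun x y hxy => ?_⟩
    · rw [← Zsqrtd.norm_eq_one_iff, hnw] at hu
      exact hp.one_lt.ne' (by simpa using hu)
    · have h1 : x.norm.natAbs * y.norm.natAbs = p := by
        rw [← Int.natAbs_mul, ← Zsqrtd.norm_mul, ← hxy, hnw, Int.natAbs_natCast]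
      rw [← Zsqrtd.norm_eq_one_iff, ← Zsqrtd.norm_eq_one_iff]
      rcases (Nat.dvd_prime hp).1 (Dvd.intro _ h1) with h | h
      · exact Or.inl h
      · right
        rw [h] at h1
        exact Nat.eq_of_mul_eq_mul_left hp.pos (by rw [h1, mul_one])
  have hprime : Prime w := hirr.prime
  have hdvd : ∀ z : GaussianInt, w ∣ z → (p : ℤ) ∣ z.norm := fun z ⟨t, ht⟩ => by
    rw [ht, Zsqrtd.norm_mul, hnw]; exact Dvd.intro _ rfl
  have hstar : ¬ w ∣ star w := fun h => by
    have h1 := hdvd _ (dvd_add dvd_rfl h)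
    have h2 : (w + star w).norm = (2 * u : ℤ) ^ 2 := by
      rw [Zsqrtd.norm_def]; simp [hw]; ring
    rw [h2] at h1
    have h3 : p ∣ u := by
      have := hpz.dvd_of_dvd_pow h1
      have : p ∣ 2 * u := by exact_mod_cast this
      exact (hp.dvd_mul.1 this).resolve_left fun h => hp2 ((Nat.prime_dvd_prime_iff_eq hp
        Nat.prime_two).1 h)
    have h4 : p ∣ v := hp.dvd_of_dvd_pow (n := 2) ((Nat.dvd_add_right (h3.trans (dvd_pow_self u
      two_ne_zero))).1 (huv ▸ dvd_rfl))
    obtain ⟨x, rfl⟩ := h3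
    obtain ⟨y, rfl⟩ := h4
    have : p * (p * (x ^ 2 + y ^ 2)) = p * 1 := by rw [mul_one]; nth_rw 3 [← huv]; ring
    exact hp.one_lt.ne' (Nat.eq_one_of_mul_eq_one_right (Nat.eq_of_mul_eq_mul_left hp.pos this))
  have hw0 : w ≠ 0 := hprime.ne_zero
  let z : ℤ × ℤ → GaussianInt := fun μ => ⟨μ.1, μ.2⟩
  have hz : ∀ μ, (z μ).norm = μ.1 ^ 2 + μ.2 ^ 2 := fun μ => by
    simp only [z, Zsqrtd.norm_def]; ring
  have hzinj : ∀ μ ν, z μ = z ν → μ = ν := fun μ ν h =>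
    Prod.ext (congrArg Zsqrtd.re h) (congrArg Zsqrtd.im h)
  let g : Bool × (ℤ × ℤ) → GaussianInt := fun q => (bif q.1 then w else star w) ^ a * z q.2
  have hgnorm : ∀ q ∈ (Finset.univ : Finset Bool) ×ˢ latticeSet m,
      (g q).norm = ((p ^ a * m : ℕ) : ℤ) := fun q hq => by
    have h1 := mem_latticeSet.1 (Finset.mem_product.1 hq).2
    have hpow : ∀ t : GaussianInt, (t ^ a).norm = t.norm ^ a := fun t => map_pow Zsqrtd.normMonoidHom t a
    simp only [g]
    rw [Zsqrtd.norm_mul, hz, h1, hpow]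
    cases q.1 <;> simp [Zsqrtd.norm_conj, hnw]
  have hcross : ∀ μ ν, ν ∈ latticeSet m → w ^ a * z μ ≠ star w ^ a * z ν := fun μ ν hν h => by
    have h1 : w ∣ star w ^ a * z ν := h ▸ (dvd_pow_self w ha).mul_right _
    rcases hprime.dvd_mul.1 h1 with h2 | h2
    · exact hstar (hprime.dvd_of_dvd_pow h2)
    · have := hdvd _ h2
      rw [hz, mem_latticeSet.1 hν] at this
      exact hpm (by exact_mod_cast this)
  have hcard : ((Finset.univ : Finset Bool) ×ˢ latticeSet m).card ≤
      (latticeSet (p ^ a * m)).card := by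
    refine Finset.card_le_card_of_injOn (fun q => ((g q).re, (g q).im)) (fun q hq => ?_) ?_
    · refine mem_latticeSet.2 ?_
      rw [← hgnorm q hq, Zsqrtd.norm_def]
      ring
    · rintro ⟨b, μ⟩ hq ⟨b', ν⟩ hq' h
      have hg : g (b, μ) = g (b', ν) := Zsqrtd.ext (congrArg Prod.fst h) (congrArg Prod.snd h)
      have hμ := (Finset.mem_product.1 hq).2
      have hν := (Finset.mem_product.1 hq').2
      cases b <;> cases b' <;> simp only [g, cond_true, cond_false] at hg
      · exact Prod.ext rfl (hzinj _ _ (mul_left_cancel₀ (pow_ne_zero a (star_ne_zero.2 hw0)) hg))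
      · exact absurd hg.symm (hcross _ _ hμ)
      · exact absurd hg (hcross _ _ hν)
      · exact Prod.ext rfl (hzinj _ _ (mul_left_cancel₀ (pow_ne_zero a hw0) hg))
  simpa using hcard

theorem two_pow_card_primeFactors_le {m : ℕ} (hm : 0 < m) (hrep : (latticeSet m).Nonempty) :
    2 ^ (m.primeFactors.filter (fun p => p % 4 = 1)).card ≤ (latticeSet m).card := by
  have hiff : ∀ {n : ℕ}, (latticeSet n).Nonempty ↔ ∃ x y : ℕ, n = x ^ 2 + y ^ 2 := fun {n} => by
    constructor
    · rintro ⟨μ, hμ⟩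
      refine ⟨μ.1.natAbs, μ.2.natAbs, ?_⟩
      have := mem_latticeSet.1 hμ
      zify
      simpa using this.symm
    · rintro ⟨x, y, rfl⟩
      exact ⟨(x, y), mem_latticeSet.2 (by push_cast; rfl)⟩
  induction m using Nat.strong_induction_on with
  | _ m ih =>
    rcases (m.primeFactors.filter (fun p => p % 4 = 1)).eq_empty_or_nonempty with h0 | ⟨p, hp⟩
    · rw [h0]
      simpa using hrep.card_pos
    · obtain ⟨hpm, hp1⟩ := Finset.mem_filter.1 hp
      have hpp := Nat.prime_of_mem_primeFactors hpm
      have : Fact p.Prime := ⟨hpp⟩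
      obtain ⟨u, v, huv⟩ := Nat.Prime.sq_add_sq (p := p) (by omega)
      obtain ⟨a, m', hpm', hmm⟩ := Nat.exists_eq_pow_mul_and_not_dvd hm.ne' p hpp.ne_one
      have ha : a ≠ 0 := by
        rintro rfl
        exact hpm' (by simpa [hmm] using Nat.dvd_of_mem_primeFactors hpm)
      have hm'0 : m' ≠ 0 := by rintro rfl; simp at hpm'
      have hlt : m' < m := by
        rw [hmm]
        exact lt_mul_of_one_lt_left (by omega) (Nat.one_lt_pow ha hpp.one_lt)
      have hpf : m.primeFactors = insert p m'.primeFactors := by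
        rw [hmm, Nat.primeFactors_mul (pow_ne_zero _ hpp.ne_zero) hm'0,
          Nat.primeFactors_prime_pow ha hpp]
        rfl
      have hpn : p ∉ m'.primeFactors := fun h => hpm' (Nat.dvd_of_mem_primeFactors h)
      have hrep' : (latticeSet m').Nonempty := by
        rw [hiff, Nat.eq_sq_add_sq_iff] at hrep ⊢
        intro q hq hq3
        have hev := hrep (q := q) (by rw [hpf]; exact Finset.mem_insert_of_mem hq) hq3
        have hqp := Nat.prime_of_mem_primeFactors hq
        have : Fact q.Prime := ⟨hqp⟩
        rw [hmm, padicValNat.mul (pow_ne_zero _ hpp.ne_zero) hm'0,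
          padicValNat.eq_zero_of_not_dvd, zero_add] at hev
        · exact hev
        · intro h
          have := (Nat.prime_dvd_prime_iff_eq hqp hpp).1 (hqp.dvd_of_dvd_pow h)
          omega
      have h1 := ih m' hlt (by omega) hrep'
      have h2 := two_mul_card_latticeSet_le hpp (by omega) huv ha hpm'
      rw [← hmm] at h2
      rw [hpf, Finset.filter_insert, if_pos hp1, Finset.card_insert_of_notMem
        (fun h => hpn (Finset.mem_filter.1 h).1), pow_succ]
      omega

theorem exists_sum_rpow_le_of_factoredNumbers {δ ε : ℝ} (hδ : 0 < δ) (hε : 0 < ε) :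
    ∃ C > 0, ∀ s A : Finset ℕ, (∀ n ∈ A, n ∈ Nat.factoredNumbers s) →
      ∑ n ∈ A, (n : ℝ) ^ (-δ) ≤ C * (2 : ℝ) ^ (ε * s.card) := by
  let f : ℕ →* ℝ :=
    { toFun := fun n => (n : ℝ) ^ (-δ)
      map_one' := by simp
      map_mul' := fun a b => by
        push_cast
        exact Real.mul_rpow (Nat.cast_nonneg a) (Nat.cast_nonneg b) }
  have hf : ∀ n, f n = (n : ℝ) ^ (-δ) := fun n => rfl
  have hf0 : ∀ n, 0 ≤ f n := fun n => Real.rpow_nonneg (Nat.cast_nonneg n) _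
  have hf2 : f 2 < 1 := Real.rpow_lt_one_of_one_lt_of_neg (by norm_num) (by linarith)
  have hfle : ∀ {p : ℕ}, p.Prime → f p ≤ f 2 := fun {p} hp =>
    Real.rpow_le_rpow_of_nonpos (by norm_num) (by exact_mod_cast hp.two_le) (by linarith)
  have hlim : Filter.Tendsto (fun n : ℕ => (1 - f n)⁻¹) Filter.atTop (nhds 1) := by
    have h1 : Filter.Tendsto (fun n : ℕ => f n) Filter.atTop (nhds 0) :=
      (tendsto_rpow_neg_atTop hδ).comp tendsto_natCast_atTop_atTop
    simpa using (h1.const_sub 1).inv₀ (by norm_num)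
  have hκ : (1 : ℝ) < 2 ^ ε := Real.one_lt_rpow (by norm_num) hε
  obtain ⟨p₀, hp₀⟩ := Filter.eventually_atTop.1 (hlim.eventually_le_const hκ)
  set K := (1 - f 2)⁻¹ with hK
  have hK1 : 1 ≤ K := (one_le_inv₀ (by linarith)).2 (by linarith [hf0 2])
  refine ⟨K ^ p₀, by positivity, fun s A hA => ?_⟩
  obtain ⟨hsum, hhas⟩ := EulerProduct.summable_and_hasSum_factoredNumbers_prod_filter_prime_geometric
    (f := f) (fun {p} hp => by
      rw [Real.norm_of_nonneg (hf0 p)]; exact (hfle hp).trans_lt hf2) s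
  have h1 : ∑ n ∈ A, (n : ℝ) ^ (-δ) ≤ ∏ p ∈ s with p.Prime, (1 - f p)⁻¹ := by
    rw [← hhas.tsum_eq, ← Finset.sum_attach]
    let e : {x // x ∈ A} ↪ Nat.factoredNumbers s :=
      ⟨fun x => ⟨x.1, hA _ x.2⟩, fun x y h => Subtype.ext (congrArg (fun z => z.1) h)⟩
    have := hhas.summable.sum_le_tsum (A.attach.map e) (fun i _ => hf0 _)
    rwa [Finset.sum_map] at this
  refine h1.trans ?_
  have h2 : ∀ p ∈ s.filter Nat.Prime, (1 - f p)⁻¹ ≤ (2 : ℝ) ^ ε * (if p < p₀ then K else 1) :=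
    fun p hp => by
      split_ifs with h
      · refine le_trans ?_ (le_mul_of_one_le_left (by linarith) hκ.le)
        exact inv_anti₀ (by linarith) (by linarith [hfle (Finset.mem_filter.1 hp).2])
      · rw [mul_one]
        exact hp₀ p (not_lt.1 h)
  refine (Finset.prod_le_prod (fun p hp => inv_nonneg.2 (by
    linarith [hfle (Finset.mem_filter.1 hp).2])) h2).trans ?_
  rw [Finset.prod_mul_distrib, Finset.prod_const, Finset.prod_ite, Finset.prod_const,
    Finset.prod_const_one, mul_one, mul_comm, Real.rpow_mul (by norm_num), Real.rpow_natCast]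
  have hc : (Finset.filter (fun p => p < p₀) (s.filter Nat.Prime)).card ≤ p₀ := by
    refine (Finset.card_le_card fun p hp => Finset.mem_range.2 (Finset.mem_filter.1 hp).2).trans ?_
    rw [Finset.card_range]
  gcongr
  · exact hκ.le
  · exact Finset.filter_subset _ _

theorem sum_inv_le_two_add_log {A : Finset ℕ} {T : ℕ} (hA : ∀ n ∈ A, 0 < n) (hT : A.card ≤ T)
    (hT0 : 0 < T) : ∑ n ∈ A, (n : ℝ)⁻¹ ≤ 2 + log T := by
  rw [← Finset.sum_filter_add_sum_filter_not A (fun n => n ≤ T)]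
  have h1 : ∑ n ∈ A with n ≤ T, (n : ℝ)⁻¹ ≤ 1 + log T := by
    have := harmonic_le_one_add_log T
    rw [harmonic_eq_sum_Icc] at this
    push_cast at this
    refine le_trans ?_ this
    refine Finset.sum_le_sum_of_subset_of_nonneg (fun n hn => ?_) fun _ _ _ => by positivity
    obtain ⟨h1, h2⟩ := Finset.mem_filter.1 hn
    exact Finset.mem_Icc.2 ⟨hA n h1, h2⟩
  have h2 : ∑ n ∈ A with ¬ n ≤ T, (n : ℝ)⁻¹ ≤ 1 := by
    have hT' : (0 : ℝ) < T := by exact_mod_cast hT0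
    calc _ ≤ ∑ n ∈ A with ¬ n ≤ T, (T : ℝ)⁻¹ := Finset.sum_le_sum fun n hn =>
          inv_anti₀ hT' (by exact_mod_cast (not_le.1 (Finset.mem_filter.1 hn).2).le)
      _ = ((A.filter (fun n => ¬ n ≤ T)).card : ℝ) * (T : ℝ)⁻¹ := by
          rw [Finset.sum_const, nsmul_eq_mul]
      _ ≤ T * (T : ℝ)⁻¹ := by
          gcongr
          exact (Finset.card_filter_le _ _).trans hT
      _ = 1 := mul_inv_cancel₀ hT'.ne'
  linarith

theorem exists_primitive_of_mem_latticeSet {m : ℕ} {μ μ' : ℤ × ℤ} (hμ : μ ∈ latticeSet m)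
    (hμ' : μ' ∈ latticeSet m) (hne : μ ≠ μ') :
    ∃ n : ℕ, ∃ κ : ℤ × ℤ, 0 < n ∧ IsCoprime κ.1 κ.2 ∧ μ - μ' = (n * κ.1, n * κ.2) ∧
      κ.1 ^ 2 + κ.2 ^ 2 ∣ 4 * (m : ℤ) := by
  rw [mem_latticeSet] at hμ hμ'
  have h0 : 0 < Int.gcd (μ.1 - μ'.1) (μ.2 - μ'.2) := by
    rw [Nat.pos_iff_ne_zero, Ne, Int.gcd_eq_zero_iff]
    rintro ⟨h1, h2⟩
    exact hne (Prod.ext (sub_eq_zero.1 h1) (sub_eq_zero.1 h2))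
  obtain ⟨a, b, hab, h1, h2⟩ := Int.exists_gcd_one h0
  set n := Int.gcd (μ.1 - μ'.1) (μ.2 - μ'.2)
  have hn : (n : ℤ) ≠ 0 := by exact_mod_cast h0.ne'
  refine ⟨n, (a, b), h0, Int.isCoprime_iff_gcd_eq_one.2 hab,
    Prod.ext (by rw [mul_comm] at h1; exact h1) (by rw [mul_comm] at h2; exact h2), ?_⟩
  obtain ⟨u, v, huv⟩ := Int.isCoprime_iff_gcd_eq_one.2 hab
  have hperp : a * (μ.1 + μ'.1) + b * (μ.2 + μ'.2) = 0 := by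
    refine (mul_eq_zero.1 ?_).resolve_left hn
    linear_combination hμ - hμ' - (μ.1 + μ'.1) * h1 - (μ.2 + μ'.2) * h2
  set l := u * (μ.2 + μ'.2) - v * (μ.1 + μ'.1)
  have hX : μ.1 + μ'.1 = -l * b := by
    simp only [l]; linear_combination u * hperp - (μ.1 + μ'.1) * huv
  have hY : μ.2 + μ'.2 = l * a := by
    simp only [l]; linear_combination v * hperp - (μ.2 + μ'.2) * huv
  refine ⟨n ^ 2 + l ^ 2, ?_⟩
  calc 4 * (m : ℤ) = (μ.1 - μ'.1) ^ 2 + (μ.2 - μ'.2) ^ 2 + (μ.1 + μ'.1) ^ 2 +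
        (μ.2 + μ'.2) ^ 2 := by linear_combination -2 * hμ - 2 * hμ'
    _ = _ := by rw [h1, h2, hX, hY]; ring

theorem card_filter_sub_eq_le_two (m : ℕ) (ν : ℤ × ℤ) :
    ((latticeSet m).offDiag.filter (fun q => q.1 - q.2 = ν)).card ≤ 2 := by
  by_contra! hcard
  obtain ⟨p, q, r, hp, hq, hr, hpq, hpr, hqr⟩ := Finset.two_lt_card_iff.1 hcard
  have hmem : ∀ t ∈ (latticeSet m).offDiag.filter (fun q => q.1 - q.2 = ν),
      t.1.1 ^ 2 + t.1.2 ^ 2 = (m : ℤ) ∧ t.2 = t.1 - ν ∧ ν ≠ 0 ∧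
        2 * (t.1.1 * ν.1 + t.1.2 * ν.2) = ν.1 ^ 2 + ν.2 ^ 2 := fun t ht => by
    obtain ⟨h1, h2⟩ := Finset.mem_filter.1 ht
    obtain ⟨h3, h4, h5⟩ := Finset.mem_offDiag.1 h1
    rw [mem_latticeSet] at h3 h4
    have h6 : t.2 = t.1 - ν := by rw [← h2]; abel
    refine ⟨h3, h6, fun h => h5 (by rw [h6, h, sub_zero]), ?_⟩
    rw [h6, Prod.fst_sub, Prod.snd_sub] at h4
    linear_combination h3 - h4
  obtain ⟨hp1, hp2, hν, hp3⟩ := hmem p hp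
  obtain ⟨hq1, hq2, -, hq3⟩ := hmem q hq
  obtain ⟨hr1, hr2, -, hr3⟩ := hmem r hr
  have id := prod_sq_sides_eq (n := m) (x := p.1.1) (y := p.1.2) (a := q.1.1 - p.1.1)
    (b := q.1.2 - p.1.2) (c := r.1.1 - p.1.1) (d := r.1.2 - p.1.2) hp1 (by simpa using hq1)
    (by simpa using hr1)
  have hD : (q.1.1 - p.1.1) * (r.1.2 - p.1.2) - (q.1.2 - p.1.2) * (r.1.1 - p.1.1) = 0 := by
    by_contra hD
    refine hν (Prod.ext ((mul_eq_zero.1 ?_).resolve_left hD)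
      ((mul_eq_zero.1 ?_).resolve_left hD))
    · have : 2 * (((q.1.1 - p.1.1) * (r.1.2 - p.1.2) - (q.1.2 - p.1.2) * (r.1.1 - p.1.1)) * ν.1)
          = 0 := by
        linear_combination (r.1.2 - p.1.2) * (hq3 - hp3) - (q.1.2 - p.1.2) * (hr3 - hp3)
      omega
    · have : 2 * (((q.1.1 - p.1.1) * (r.1.2 - p.1.2) - (q.1.2 - p.1.2) * (r.1.1 - p.1.1)) * ν.2)
          = 0 := by
        linear_combination (q.1.1 - p.1.1) * (hr3 - hp3) - (r.1.1 - p.1.1) * (hq3 - hp3)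
      omega
  rw [hD] at id
  have hsq : ∀ s t : (ℤ × ℤ) × (ℤ × ℤ), s.2 = s.1 - ν → t.2 = t.1 - ν →
      (s.1.1 - t.1.1) ^ 2 + (s.1.2 - t.1.2) ^ 2 = 0 → s = t := fun s t hs ht h => by
    have h1 : s.1 = t.1 := by
      obtain ⟨h1, h2⟩ := (add_eq_zero_iff_of_nonneg (sq_nonneg _) (sq_nonneg _)).1 h
      exact Prod.ext (sub_eq_zero.1 (pow_eq_zero_iff two_ne_zero |>.1 h1))
        (sub_eq_zero.1 (pow_eq_zero_iff two_ne_zero |>.1 h2))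
    exact Prod.ext h1 (by rw [hs, ht, h1])
  rw [sub_sub_sub_cancel_right, sub_sub_sub_cancel_right] at id
  simp only [ne_eq, OfNat.ofNat_ne_zero, not_false_eq_true, zero_pow, mul_zero,
    mul_eq_zero] at id
  rcases id with (h | h) | h
  · exact hpq (hsq q p hq2 hp2 h).symm
  · exact hpr (hsq r p hr2 hp2 h).symm
  · exact hqr (hsq q r hq2 hr2 h)

theorem natAbs_mem_factoredNumbers {m : ℕ} (hm : 0 < m) {κ : ℤ × ℤ} (hκ : IsCoprime κ.1 κ.2)
    (hdvd : κ.1 ^ 2 + κ.2 ^ 2 ∣ 4 * (m : ℤ)) :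
    (κ.1 ^ 2 + κ.2 ^ 2).natAbs ∈
      Nat.factoredNumbers (insert 2 (m.primeFactors.filter (fun p => p % 4 = 1))) := by
  set P := (κ.1 ^ 2 + κ.2 ^ 2).natAbs with hP
  have hPz : (P : ℤ) = κ.1 ^ 2 + κ.2 ^ 2 := Int.natAbs_of_nonneg (by positivity)
  have hdvd' : P ∣ 4 * m := by rw [← hPz] at hdvd; exact_mod_cast hdvd
  rw [Nat.mem_factoredNumbers']
  intro q hq hqP
  rw [Finset.mem_insert, or_iff_not_imp_left]
  intro hq2
  have hqm : q ∣ m := by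
    refine (hq.dvd_mul.1 (hqP.trans hdvd')).resolve_left fun h => hq2 ?_
    exact (Nat.prime_dvd_prime_iff_eq hq Nat.prime_two).1
      (hq.dvd_of_dvd_pow (show q ∣ 2 ^ 2 from h))
  have hsq := ZMod.isSquare_neg_one_of_eq_sq_add_sq_of_isCoprime (n := P) hPz hκ
  have hP0 : P ≠ 0 := ne_zero_of_dvd_ne_zero (by positivity) hdvd'
  have h3 := Nat.mod_four_ne_three_of_mem_primeFactors_of_isSquare_neg_one
    (Nat.mem_primeFactors.2 ⟨hq, hqP, hP0⟩) hsq
  have := hq.eq_two_or_odd.resolve_left hq2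
  exact Finset.mem_filter.2 ⟨Nat.mem_primeFactors.2 ⟨hq, hqm, hm.ne'⟩, by omega⟩

theorem sum_inv_sqrt_le_sum_rpow {V : Finset (ℤ × ℤ)}
    (hV : ∀ κ ∈ V, 0 < (κ.1 ^ 2 + κ.2 ^ 2).natAbs) :
    ∑ κ ∈ V, (√((κ.1 : ℝ) ^ 2 + (κ.2 : ℝ) ^ 2))⁻¹ ≤
      48 * ∑ P ∈ Finset.image (β := ℕ) (fun κ => (κ.1 ^ 2 + κ.2 ^ 2).natAbs) V,
        (P : ℝ) ^ (-(1 / 6) : ℝ) := by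
  rw [← Finset.sum_fiberwise_of_maps_to (g := fun κ : ℤ × ℤ => (κ.1 ^ 2 + κ.2 ^ 2).natAbs)
    fun κ hκ => Finset.mem_image.2 ⟨κ, hκ, rfl⟩, Finset.mul_sum]
  refine Finset.sum_le_sum fun P hP => ?_
  obtain ⟨κ₀, hκ₀, hκP⟩ := Finset.mem_image.1 hP
  have hP0 : 0 < P := hκP ▸ hV κ₀ hκ₀
  have hP0' : (0 : ℝ) < P := by exact_mod_cast hP0
  have heq : ∀ κ ∈ V.filter (fun κ => (κ.1 ^ 2 + κ.2 ^ 2).natAbs = P),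
      κ.1 ^ 2 + κ.2 ^ 2 = (P : ℤ) := fun κ hκ => by
    rw [← (Finset.mem_filter.1 hκ).2, Int.natAbs_of_nonneg (by positivity)]
  calc _ = ∑ κ ∈ V.filter (fun κ => (κ.1 ^ 2 + κ.2 ^ 2).natAbs = P), (P : ℝ) ^ (-(1 / 2) : ℝ) :=
        Finset.sum_congr rfl fun κ hκ => by
          have : (κ.1 : ℝ) ^ 2 + (κ.2 : ℝ) ^ 2 = P := by exact_mod_cast heq κ hκ
          rw [this, Real.rpow_neg hP0'.le, Real.sqrt_eq_rpow]
    _ = ((V.filter (fun κ => (κ.1 ^ 2 + κ.2 ^ 2).natAbs = P)).card : ℝ) *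
          (P : ℝ) ^ (-(1 / 2) : ℝ) := by rw [Finset.sum_const, nsmul_eq_mul]
    _ ≤ (48 * (P : ℝ) ^ (1 / 3 : ℝ)) * (P : ℝ) ^ (-(1 / 2) : ℝ) := by
        gcongr
        refine le_trans ?_ (card_latticeSet_le hP0)
        exact_mod_cast Finset.card_le_card fun κ hκ => mem_latticeSet.2 (heq κ hκ)
    _ = _ := by
        rw [mul_assoc, ← Real.rpow_add hP0']
        norm_num

theorem sum_offDiag_le_sum_image {m : ℕ} {F : ℤ × ℤ → ℝ} (hF : ∀ ν, 0 ≤ F ν) :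
    ∑ q ∈ (latticeSet m).offDiag, F (q.1 - q.2) ≤
      2 * ∑ ν ∈ (latticeSet m).offDiag.image (fun q => q.1 - q.2), F ν := by
  rw [Finset.sum_comp F (fun q : (ℤ × ℤ) × (ℤ × ℤ) => q.1 - q.2), Finset.mul_sum]
  refine Finset.sum_le_sum fun ν _ => ?_
  rw [nsmul_eq_mul]
  gcongr
  · exact hF ν
  · exact_mod_cast card_filter_sub_eq_le_two m ν

theorem sum_inv_sqrt_le_log_mul_sum {D : Finset (ℤ × ℤ)} {T : ℕ} (hT0 : 0 < T) (hT : D.card ≤ T)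
    {n : ℤ × ℤ → ℕ} {κ : ℤ × ℤ → ℤ × ℤ} (hn : ∀ ν ∈ D, 0 < n ν)
    (hκ : ∀ ν ∈ D, ν = (n ν * (κ ν).1, n ν * (κ ν).2)) :
    ∑ ν ∈ D, (√((ν.1 : ℝ) ^ 2 + (ν.2 : ℝ) ^ 2))⁻¹ ≤
      (2 + log T) * ∑ ξ ∈ D.image κ, (√((ξ.1 : ℝ) ^ 2 + (ξ.2 : ℝ) ^ 2))⁻¹ := by
  rw [← Finset.sum_fiberwise_of_maps_to (g := κ) fun ν hν => Finset.mem_image_of_mem _ hν,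
    Finset.mul_sum]
  refine Finset.sum_le_sum fun ξ _ => ?_
  have hfib : ∀ ν ∈ D.filter (fun ν => κ ν = ξ), ν = (n ν * ξ.1, n ν * ξ.2) := fun ν hν => by
    obtain ⟨h1, h2⟩ := Finset.mem_filter.1 hν
    have := hκ ν h1
    rwa [h2] at this
  have hinj : Set.InjOn n (D.filter (fun ν => κ ν = ξ)) := fun ν hν ν' hν' h => by
    rw [hfib ν hν, hfib ν' hν', h]
  calc _ = ∑ ν ∈ D.filter (fun ν => κ ν = ξ), (n ν : ℝ)⁻¹ *
        (√((ξ.1 : ℝ) ^ 2 + (ξ.2 : ℝ) ^ 2))⁻¹ := Finset.sum_congr rfl fun ν hν => by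
          have h := hfib ν hν
          have h1 : (ν.1 : ℝ) = n ν * ξ.1 := by exact_mod_cast congrArg Prod.fst h
          have h2 : (ν.2 : ℝ) = n ν * ξ.2 := by exact_mod_cast congrArg Prod.snd h
          rw [h1, h2, mul_pow, mul_pow, ← mul_add, Real.sqrt_mul (by positivity),
            Real.sqrt_sq (by positivity), mul_inv]
    _ = (∑ j ∈ (D.filter (fun ν => κ ν = ξ)).image n, (j : ℝ)⁻¹) *
        (√((ξ.1 : ℝ) ^ 2 + (ξ.2 : ℝ) ^ 2))⁻¹ := by
          rw [Finset.sum_image hinj, Finset.sum_mul]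
    _ ≤ _ := by
        gcongr
        refine sum_inv_le_two_add_log (fun j hj => ?_) ?_ hT0
        · obtain ⟨ν, hν, rfl⟩ := Finset.mem_image.1 hj
          exact hn ν (Finset.mem_filter.1 hν).1
        · exact Finset.card_image_le.trans ((Finset.card_filter_le _ _).trans hT)

theorem exists_sum_offDiag_inv_sqrt_le {ε : ℝ} (hε : 0 < ε) : ∃ C > 0, ∀ m : ℕ, 0 < m →
    (latticeSet m).Nonempty → ∑ q ∈ (latticeSet m).offDiag,
      (√(((q.1 - q.2).1 : ℝ) ^ 2 + ((q.1 - q.2).2 : ℝ) ^ 2))⁻¹ ≤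
        C * ((latticeSet m).card : ℝ) ^ ε := by
  obtain ⟨C, hC, hsum⟩ :=
    exists_sum_rpow_le_of_factoredNumbers (δ := 1 / 6) (by norm_num) (half_pos hε)
  refine ⟨2 * ((2 + 2 / (ε / 2)) * (48 * (C * 2 ^ (ε / 2)))), by positivity,
    fun m hm hrep => ?_⟩
  set N := (latticeSet m).card with hN
  have hN1 : 1 ≤ N := Finset.card_pos.2 hrep
  have hN1' : (1 : ℝ) ≤ N := by exact_mod_cast hN1
  set D := (latticeSet m).offDiag.image (fun q => q.1 - q.2) with hD
  have hprim : ∀ ν ∈ D, ∃ n : ℕ, ∃ κ : ℤ × ℤ, 0 < n ∧ IsCoprime κ.1 κ.2 ∧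
      ν = (n * κ.1, n * κ.2) ∧ κ.1 ^ 2 + κ.2 ^ 2 ∣ 4 * (m : ℤ) := fun ν hν => by
    obtain ⟨q, hq, rfl⟩ := Finset.mem_image.1 hν
    obtain ⟨h1, h2, h3⟩ := Finset.mem_offDiag.1 hq
    exact exists_primitive_of_mem_latticeSet h1 h2 h3
  choose! n κ hn hcop hκ hdvd using hprim
  have hDcard : D.card ≤ N ^ 2 := by
    refine Finset.card_image_le.trans ?_
    rw [Finset.offDiag_card, sq]
    exact Nat.sub_le _ _
  have hfact : ∀ P ∈ (D.image κ).image (fun κ => (κ.1 ^ 2 + κ.2 ^ 2).natAbs),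
      P ∈ Nat.factoredNumbers (insert 2 (m.primeFactors.filter (fun p => p % 4 = 1))) := by
    simp only [Finset.forall_mem_image]
    exact fun ν hν => natAbs_mem_factoredNumbers hm (hcop ν hν) (hdvd ν hν)
  have hlog : 2 + log ((N ^ 2 : ℕ) : ℝ) ≤ (2 + 2 / (ε / 2)) * (N : ℝ) ^ (ε / 2) := by
    have h1 := Real.log_le_rpow_div (zero_le_one.trans hN1') (half_pos hε)
    have h2 := Real.one_le_rpow hN1' (half_pos hε).le
    rw [Nat.cast_pow, Real.log_pow]
    calc 2 + ((2 : ℕ) : ℝ) * log N ≤ 2 * (N : ℝ) ^ (ε / 2) + 2 * ((N : ℝ) ^ (ε / 2) / (ε / 2)) := by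
          push_cast
          linarith
      _ = _ := by ring
  have hpow : (2 : ℝ) ^ (ε / 2 * ((insert 2 (m.primeFactors.filter
      (fun p => p % 4 = 1))).card : ℝ)) ≤ 2 ^ (ε / 2) * (N : ℝ) ^ (ε / 2) := by
    set w := m.primeFactors.filter (fun p => p % 4 = 1)
    have h1 : ((insert 2 w).card : ℝ) ≤ w.card + 1 := by exact_mod_cast Finset.card_insert_le 2 w
    calc _ ≤ (2 : ℝ) ^ (ε / 2 * (w.card + 1)) := by
          gcongr
          norm_num
      _ = 2 ^ (ε / 2) * ((2 : ℝ) ^ w.card) ^ (ε / 2) := by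
          rw [← Real.rpow_natCast, ← Real.rpow_mul (by norm_num), ← Real.rpow_add (by norm_num)]
          ring_nf
      _ ≤ _ := by
          gcongr
          exact_mod_cast two_pow_card_primeFactors_le hm hrep
  calc _ ≤ 2 * ∑ ν ∈ D, (√((ν.1 : ℝ) ^ 2 + (ν.2 : ℝ) ^ 2))⁻¹ :=
        sum_offDiag_le_sum_image (F := fun ν => (√((ν.1 : ℝ) ^ 2 + (ν.2 : ℝ) ^ 2))⁻¹)
          fun ν => by positivity
    _ ≤ 2 * ((2 + log ((N ^ 2 : ℕ) : ℝ)) *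
          ∑ ξ ∈ D.image κ, (√((ξ.1 : ℝ) ^ 2 + (ξ.2 : ℝ) ^ 2))⁻¹) := by
        gcongr
        exact sum_inv_sqrt_le_log_mul_sum (by positivity) hDcard hn hκ
    _ ≤ 2 * ((2 + 2 / (ε / 2)) * (N : ℝ) ^ (ε / 2) *
          (48 * (C * (2 ^ (ε / 2) * (N : ℝ) ^ (ε / 2))))) := by
        gcongr
        refine (sum_inv_sqrt_le_sum_rpow ?_).trans ?_
        · simp only [Finset.forall_mem_image]
          intro ν hν
          exact Nat.pos_of_ne_zero (Nat.ne_zero_of_mem_factoredNumbers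
            (natAbs_mem_factoredNumbers hm (hcop ν hν) (hdvd ν hν)))
        · gcongr
          exact (hsum _ _ hfact).trans (mul_le_mul_of_nonneg_left hpow hC.le)
    _ = 2 * ((2 + 2 / (ε / 2)) * (48 * (C * 2 ^ (ε / 2)))) *
          ((N : ℝ) ^ (ε / 2) * (N : ℝ) ^ (ε / 2)) := by ring
    _ = _ := by rw [← Real.rpow_add (by linarith), add_halves]

/-- The squared modulus of the Fourier transform at `ν` of arc length on the curve
`γ : [0, L] → ℝ²`. -/
def curveFourierSq (L : ℝ) (γ : ℝ → ℝ × ℝ) (ν : ℤ × ℤ) : ℝ :=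
  (∫ t in (0 : ℝ)..L, cos (2 * π * ((ν.1 : ℝ) * (γ t).1 + (ν.2 : ℝ) * (γ t).2))) ^ 2 +
    (∫ t in (0 : ℝ)..L, sin (2 * π * ((ν.1 : ℝ) * (γ t).1 + (ν.2 : ℝ) * (γ t).2))) ^ 2

theorem sq_add_sq_pos_of_ne_zero {R : Type*} [CommRing R] [LinearOrder R] [IsStrictOrderedRing R]
    {p : R × R} (hp : p ≠ 0) : 0 < p.1 ^ 2 + p.2 ^ 2 := by
  refine (add_nonneg (sq_nonneg _) (sq_nonneg _)).lt_of_ne' fun h => ?_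
  obtain ⟨h1, h2⟩ := (add_eq_zero_iff_of_nonneg (sq_nonneg _) (sq_nonneg _)).1 h
  exact hp (Prod.ext (eq_zero_of_pow_eq_zero h1) (eq_zero_of_pow_eq_zero h2))

theorem sq_sum_cos_eq {m : ℕ} (A : ℤ × ℤ →+ ℝ) :
    (∑ μ ∈ latticeSet m, cos (A μ)) ^ 2 =
      ∑ q ∈ latticeSet m ×ˢ latticeSet m, cos (A (q.1 - q.2)) := by
  have hsin : ∑ μ ∈ latticeSet m, sin (A μ) = 0 := by
    have : ∑ μ ∈ latticeSet m, sin (A μ) = ∑ μ ∈ latticeSet m, -sin (A μ) :=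
      Finset.sum_nbij' (fun μ => -μ) (fun μ => -μ)
        (fun μ hμ => by rw [mem_latticeSet] at hμ ⊢; simpa using hμ)
        (fun μ hμ => by rw [mem_latticeSet] at hμ ⊢; simpa using hμ)
        (fun μ _ => neg_neg μ) (fun μ _ => neg_neg μ) (fun μ _ => by simp)
    rw [Finset.sum_neg_distrib] at this
    linarith
  simp only [map_sub, cos_sub, Finset.sum_add_distrib]
  rw [Finset.sum_product, Finset.sum_product]
  dsimp only
  rw [← Finset.sum_mul_sum, ← Finset.sum_mul_sum, hsin]
  ring

theorem integral_integral_cos_sub {L : ℝ} {φ : ℝ → ℝ} (hφ : Continuous φ) :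
    ∫ t₁ in (0 : ℝ)..L, ∫ t₂ in (0 : ℝ)..L, cos (φ t₁ - φ t₂) =
      (∫ t in (0 : ℝ)..L, cos (φ t)) ^ 2 + (∫ t in (0 : ℝ)..L, sin (φ t)) ^ 2 := by
  have h : ∀ t₁, ∫ t₂ in (0 : ℝ)..L, cos (φ t₁ - φ t₂) =
      cos (φ t₁) * (∫ t in (0 : ℝ)..L, cos (φ t)) +
        sin (φ t₁) * (∫ t in (0 : ℝ)..L, sin (φ t)) := fun t₁ => by
    simp only [cos_sub]
    rw [intervalIntegral.integral_add (Continuous.intervalIntegrable (by fun_prop) _ _)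
      (Continuous.intervalIntegrable (by fun_prop) _ _), intervalIntegral.integral_const_mul,
      intervalIntegral.integral_const_mul]
  simp only [h]
  rw [intervalIntegral.integral_add (Continuous.intervalIntegrable (by fun_prop) _ _)
    (Continuous.intervalIntegrable (by fun_prop) _ _), intervalIntegral.integral_mul_const,
    intervalIntegral.integral_mul_const]
  ring

theorem integral_integral_covFn_sq {L : ℝ} {γ : ℝ → ℝ × ℝ} (hγ : Continuous γ) (m : ℕ) :
    ∫ t₁ in (0 : ℝ)..L, ∫ t₂ in (0 : ℝ)..L, covFn m γ t₁ t₂ ^ 2 =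
      ((latN m : ℝ)⁻¹) ^ 2 * ∑ q ∈ latticeSet m ×ˢ latticeSet m,
        curveFourierSq L γ (q.1 - q.2) := by
  let φ : ℤ × ℤ → ℝ → ℝ := fun ν t => 2 * π * ((ν.1 : ℝ) * (γ t).1 + (ν.2 : ℝ) * (γ t).2)
  have hφ : ∀ ν, Continuous (φ ν) := fun ν => by fun_prop
  have hcov : ∀ t₁ t₂, covFn m γ t₁ t₂ ^ 2 = ((latN m : ℝ)⁻¹) ^ 2 *
      ∑ q ∈ latticeSet m ×ˢ latticeSet m, cos (φ (q.1 - q.2) t₁ - φ (q.1 - q.2) t₂) :=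
    fun t₁ t₂ => by
      let A : ℤ × ℤ →+ ℝ :=
        { toFun := fun ν => 2 * π * ((ν.1 : ℝ) * (γ t₁ - γ t₂).1 + (ν.2 : ℝ) * (γ t₁ - γ t₂).2)
          map_zero' := by simp
          map_add' := fun a b => by simp only [Prod.fst_add, Prod.snd_add]; push_cast; ring }
      rw [covFn, mul_pow]
      congr 1
      refine (sq_sum_cos_eq A).trans (Finset.sum_congr rfl fun q _ => ?_)
      congr 1
      simp only [A, φ, AddMonoidHom.coe_mk, ZeroHom.coe_mk, Prod.fst_sub, Prod.snd_sub]
      ring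
  simp only [hcov, intervalIntegral.integral_const_mul]
  congr 1
  have hinner : ∀ t₁, ∫ t₂ in (0 : ℝ)..L, ∑ q ∈ latticeSet m ×ˢ latticeSet m,
      cos (φ (q.1 - q.2) t₁ - φ (q.1 - q.2) t₂) = ∑ q ∈ latticeSet m ×ˢ latticeSet m,
        ∫ t₂ in (0 : ℝ)..L, cos (φ (q.1 - q.2) t₁ - φ (q.1 - q.2) t₂) := fun t₁ =>
    intervalIntegral.integral_finsetSum fun q _ =>
      Continuous.intervalIntegrable (by have := hφ (q.1 - q.2); fun_prop) _ _
  simp only [hinner]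
  rw [intervalIntegral.integral_finsetSum]
  · exact Finset.sum_congr rfl fun q _ => integral_integral_cos_sub (hφ _)
  · intro q _
    have := hφ (q.1 - q.2)
    refine Continuous.intervalIntegrable ?_ _ _
    exact intervalIntegral.continuous_parametric_intervalIntegral_of_continuous'
      (by fun_prop) _ _

/-- Second moment of the covariance function along the curve:
`∫∫ r² = L²/N + O(N^{ε−2})`. -/
theorem second_moment_covariance
    (L : ℝ) (hL : 0 < L) (γ : ℝ → ℝ × ℝ) (hγ : ContDiff ℝ (⊤ : ℕ∞) γ)
    (hunit : ∀ t ∈ Set.Icc (0:ℝ) L, (deriv γ t).1 ^ 2 + (deriv γ t).2 ^ 2 = 1)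
    (hcurv : ∀ t ∈ Set.Icc (0:ℝ) L, deriv (deriv γ) t ≠ 0) :
    ∀ ε > (0:ℝ), ∃ C > 0, ∀ m : ℕ, 0 < m →
      (∃ a b : ℤ, a ^ 2 + b ^ 2 = (m : ℤ)) →
      |(∫ t₁ in (0:ℝ)..L, ∫ t₂ in (0:ℝ)..L, covFn m γ t₁ t₂ ^ 2) - L ^ 2 / latN m|
        ≤ C * (latN m : ℝ) ^ (ε - 2) := by
  intro ε hε
  have hderiv : ∀ {f : ℝ → ℝ × ℝ}, Differentiable ℝ f →
      (deriv fun t => (f t).1) = (fun t => (deriv f t).1) ∧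
        (deriv fun t => (f t).2) = (fun t => (deriv f t).2) := fun hf =>
    ⟨funext fun t => ((ContinuousLinearMap.fst ℝ ℝ ℝ).hasFDerivAt.comp_hasDerivAt t
        (hf t).hasDerivAt).deriv,
      funext fun t => ((ContinuousLinearMap.snd ℝ ℝ ℝ).hasFDerivAt.comp_hasDerivAt t
        (hf t).hasDerivAt).deriv⟩
  obtain ⟨hx1, hy1⟩ := hderiv (hγ.differentiable (by simp))
  obtain ⟨hx2, hy2⟩ := hderiv ((contDiff_infty_iff_deriv.1 hγ).2.differentiable (by simp))
  obtain ⟨C₁, hC₁, hcurve⟩ := exists_sq_integral_cos_add_sq_integral_sin_le hL hγ.fst hγ.snd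
    (by simpa only [hx1, hy1] using hunit) (fun t ht => by
      rw [hx1, hy1, hx2, hy2]
      exact sq_add_sq_pos_of_ne_zero (hcurv t ht))
  obtain ⟨C₂, hC₂, hpair⟩ := exists_sum_offDiag_inv_sqrt_le hε
  refine ⟨C₁ * C₂, by positivity, fun m hm hrep => ?_⟩
  have hne : (latticeSet m).Nonempty := by
    obtain ⟨a, b, hab⟩ := hrep
    exact ⟨(a, b), mem_latticeSet.2 hab⟩
  have hN : (0 : ℝ) < latN m := by exact_mod_cast Finset.card_pos.2 hne
  have hG0 : curveFourierSq L γ 0 = L ^ 2 := by simp [curveFourierSq]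
  have hoff : ∑ q ∈ (latticeSet m).offDiag, curveFourierSq L γ (q.1 - q.2) ≤ C₁ * (C₂ * (latN m : ℝ) ^ ε) := by
    refine le_trans ?_ (mul_le_mul_of_nonneg_left (hpair m hm hne) hC₁.le)
    rw [Finset.mul_sum]
    refine Finset.sum_le_sum fun q hq => ?_
    refine hcurve _ _ ?_
    have hq' := sq_add_sq_pos_of_ne_zero (sub_ne_zero.2 (Finset.mem_offDiag.1 hq).2.2)
    exact_mod_cast hq'
  have hoff0 : 0 ≤ ∑ q ∈ (latticeSet m).offDiag, curveFourierSq L γ (q.1 - q.2) :=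
    Finset.sum_nonneg fun q _ => add_nonneg (sq_nonneg _) (sq_nonneg _)
  have hsplit : ∑ q ∈ latticeSet m ×ˢ latticeSet m, curveFourierSq L γ (q.1 - q.2) =
      latN m * L ^ 2 + ∑ q ∈ (latticeSet m).offDiag, curveFourierSq L γ (q.1 - q.2) := by
    rw [← Finset.diag_union_offDiag, Finset.sum_union (Finset.disjoint_diag_offDiag _),
      Finset.sum_diag]
    simp only [sub_self, hG0, Finset.sum_const, nsmul_eq_mul, latN]
  have hmain : (∫ t₁ in (0:ℝ)..L, ∫ t₂ in (0:ℝ)..L, covFn m γ t₁ t₂ ^ 2) - L ^ 2 / latN m =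
      ((latN m : ℝ)⁻¹) ^ 2 * ∑ q ∈ (latticeSet m).offDiag, curveFourierSq L γ (q.1 - q.2) := by
    rw [integral_integral_covFn_sq hγ.continuous, hsplit]
    field_simp
    ring
  rw [hmain, abs_of_nonneg (mul_nonneg (sq_nonneg _) hoff0)]
  calc _ ≤ ((latN m : ℝ)⁻¹) ^ 2 * (C₁ * (C₂ * (latN m : ℝ) ^ ε)) := by gcongr
    _ = _ := by
      rw [Real.rpow_sub hN, Real.rpow_two]
      field_simp

end
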